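/- Let p ≠ q be indices in {1,…,n} and let b : Λ → (0,∞). For t ∈ ℝ let B^t denote the Λ×Λ diagonal matrix with (B^t)_{θθ} = b_θ^t. Suppose there exists θ ∈ Λ with θ_p ≥ 1 such that θ − ε_p + ε_q ∈ Λ and θ + ε_q ∉ Λ. Then the Λ×Λ matrix N := B^{−1/2} S̃_q B S̃_pᵀ B^{−1/2} − B^{1/2} S̃_pᵀ B^{−1} S̃_q B^{1/2} is nonzero. -/

import Mathlib

/-- Graded co-lexicographic order on multi-indices. -/
def gclex {n : ℕ} (β α : Fin n → ℕ) : Prop :=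
  (∑ i, β i) < ∑ i, α i ∨
    ((∑ i, β i) = ∑ i, α i ∧
      (β = α ∨ ∃ j, β j < α j ∧ ∀ k, j < k → β k = α k))

instance {n : ℕ} (β α : Fin n → ℕ) : Decidable (gclex β α) := by
  unfold gclex; infer_instance

/-- `Λ = {β : β ≤ α}` in the graded co-lexicographic order. -/
def Lam {n : ℕ} (α : Fin n → ℕ) : Type := {β : Fin n → ℕ // gclex β α}

lemma gclex_sum_le {n : ℕ} {β α : Fin n → ℕ} (h : gclex β α) :
    (∑ i, β i) ≤ ∑ i, α i := by
  rcases h with h | ⟨h, _⟩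
  · exact le_of_lt h
  · exact le_of_eq h

noncomputable instance {n : ℕ} (α : Fin n → ℕ) : Fintype (Lam α) :=
  Fintype.ofInjective
    (fun β : Lam α => fun i => (⟨β.1 i, by
      have h1 : β.1 i ≤ ∑ j, β.1 j :=
        Finset.single_le_sum (fun j _ => Nat.zero_le _) (Finset.mem_univ i)
      have h2 := gclex_sum_le β.2
      omega⟩ : Fin (∑ i, α i + 1)))
    (fun a b hab => Subtype.ext (funext fun i => congrArg Fin.val (congrFun hab i)))

instance {n : ℕ} (α : Fin n → ℕ) : DecidableEq (Lam α) :=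
  fun a b => decidable_of_iff (a.1 = b.1) Subtype.ext_iff.symm


open Matrix

/-- The weighted shift `S̃ᵢ` on `ℝ^Λ`, as a `Λ × Λ` matrix:
`S̃ᵢ e_θ = (θᵢ + 1) e_{θ + εᵢ}` if `θ + εᵢ ∈ Λ`, and `0` otherwise. -/
def StildeR {n : ℕ} (α : Fin n → ℕ) (i : Fin n) :
    Matrix (Lam α) (Lam α) ℝ :=
  Matrix.of fun η θ : Lam α =>
    if η.1 = θ.1 + Pi.single i 1 then ((θ.1 i : ℝ) + 1) else 0

/-- The diagonal matrix `Dᵢ` with `(Dᵢ)_{θθ} = θᵢ`. -/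
def DiR {n : ℕ} (α : Fin n → ℕ) (i : Fin n) : Matrix (Lam α) (Lam α) ℝ :=
  Matrix.diagonal fun θ : Lam α => (θ.1 i : ℝ)

lemma StildeR_nonneg {n : ℕ} (α : Fin n → ℕ) (i : Fin n) (η θ : Lam α) :
    0 ≤ StildeR α i η θ := by
  simp only [StildeR, Matrix.of_apply]
  split_ifs <;> positivity

lemma StildeR_pos {n : ℕ} {α : Fin n → ℕ} {i : Fin n} {η θ : Lam α}
    (h : η.1 = θ.1 + Pi.single i 1) : 0 < StildeR α i η θ := by
  simp only [StildeR, Matrix.of_apply, if_pos h]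
  positivity

lemma StildeR_eq_zero_of_not_gclex {n : ℕ} {α : Fin n → ℕ} {i : Fin n} {θ : Lam α}
    (h : ¬ gclex (θ.1 + Pi.single i 1) α) (η : Lam α) : StildeR α i η θ = 0 := by
  simp only [StildeR, Matrix.of_apply]
  refine if_neg fun hη : η.1 = θ.1 + Pi.single i 1 => h ?_
  exact hη ▸ η.2

lemma gclex_sub_single {n : ℕ} {θ α : Fin n → ℕ} {p : Fin n} (hθ : gclex θ α)
    (hp : 1 ≤ θ p) : gclex (θ - Pi.single p 1) α := by
  refine Or.inl (lt_of_lt_of_le ?_ (gclex_sum_le hθ))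
  refine Finset.sum_lt_sum (fun i _ => Nat.sub_le _ _) ⟨p, Finset.mem_univ p, ?_⟩
  simp only [Pi.sub_apply, Pi.single_eq_same]
  omega

/-- Let `p ≠ q` and `b : Λ → (0, ∞)`, and for `t ∈ ℝ` let `Bᵗ` be the
diagonal matrix with entries `b_θᵗ`.  If there is `θ ∈ Λ` with `θ_p ≥ 1`,
`θ - ε_p + ε_q ∈ Λ` and `θ + ε_q ∉ Λ`, then
`N := B^{-1/2} S̃_q B S̃_pᵀ B^{-1/2} - B^{1/2} S̃_pᵀ B⁻¹ S̃_q B^{1/2}` is nonzero. -/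
theorem stmt_5 {n : ℕ} (α : Fin n → ℕ) (p q : Fin n) (hpq : p ≠ q)
    (b : (Fin n → ℕ) → ℝ) (hb : ∀ θ, gclex θ α → 0 < b θ)
    (θ : Fin n → ℕ) (hθ : gclex θ α) (hθp : 1 ≤ θ p)
    (h1 : gclex (θ - Pi.single p 1 + Pi.single q 1) α)
    (h2 : ¬ gclex (θ + Pi.single q 1) α) :
    (fun t : ℝ => Matrix.diagonal fun η : Lam α => b η.1 ^ t) (-(1 / 2))
          * StildeR α q * (fun t : ℝ => Matrix.diagonal fun η : Lam α => b η.1 ^ t) 1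
          * (StildeR α p)ᵀ
          * (fun t : ℝ => Matrix.diagonal fun η : Lam α => b η.1 ^ t) (-(1 / 2))
        - (fun t : ℝ => Matrix.diagonal fun η : Lam α => b η.1 ^ t) (1 / 2)
          * (StildeR α p)ᵀ
          * (fun t : ℝ => Matrix.diagonal fun η : Lam α => b η.1 ^ t) (-1)
          * StildeR α q * (fun t : ℝ => Matrix.diagonal fun η : Lam α => b η.1 ^ t) (1 / 2)
      ≠ 0 := by
  intro h
  have hκ := gclex_sub_single hθ hθp
  have hθκ : θ = θ - Pi.single p 1 + Pi.single p 1 := by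
    ext i
    by_cases hi : i = p
    · subst hi
      simp only [Pi.add_apply, Pi.sub_apply, Pi.single_eq_same]
      omega
    · simp [hi]
  let η' : Lam α := ⟨_, h1⟩
  let θ' : Lam α := ⟨θ, hθ⟩
  let κ' : Lam α := ⟨_, hκ⟩
  have h0 := congrFun (congrFun h η') θ'
  simp only [Matrix.sub_apply, Matrix.mul_diagonal, Matrix.zero_apply] at h0
  rw [Matrix.mul_apply, Matrix.mul_apply,
    Finset.sum_eq_zero (s := Finset.univ) (f := fun k => _ * StildeR α q k θ')
      (fun k _ => by rw [StildeR_eq_zero_of_not_gclex h2, mul_zero])] at h0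
  simp only [Matrix.mul_diagonal, Matrix.diagonal_mul, Matrix.transpose_apply, zero_mul,
    sub_zero] at h0
  refine absurd h0 (ne_of_gt (mul_pos ?_ (Real.rpow_pos_of_pos (hb _ hθ) _)))
  refine Finset.sum_pos' (fun k _ => ?_) ⟨κ', Finset.mem_univ _, ?_⟩
  · exact mul_nonneg (mul_nonneg (mul_nonneg (Real.rpow_pos_of_pos (hb _ h1) _).le
      (StildeR_nonneg _ _ _ _)) (Real.rpow_pos_of_pos (hb _ k.2) _).le) (StildeR_nonneg _ _ _ _)
  · exact mul_pos (mul_pos (mul_pos (Real.rpow_pos_of_pos (hb _ h1) _) (StildeR_pos rfl))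
      (Real.rpow_pos_of_pos (hb _ hκ) _)) (StildeR_pos hθκ)
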